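/- arXiv:2101.00299 — 8 statements merged into one kernel-verified Lean document; each statement's English description precedes it below -/
import Mathlib

section
/- Let (Ω, F, P) be a probability space, G ⊆ F a sub-σ-algebra, and S a random variable with S > 0 almost surely such that S and log S are integrable and the conditional expectation E[S | G] is almost surely positive. Fix τ > 0 and define the random variable V² := −(2/τ)·E[log(S / E[S | G]) | G]. Then for every ξ ∈ ℝ and every pair of conjugate exponents p, q ∈ (1, ∞) with 1/p + 1/q = 1, the following inequality holds in [0, ∞]: E[exp(ξ·V²)] ≤ (1/q)·E[S^(−2ξq/τ)] + (1/p)·E[(E[S | G])^(2ξp/τ)]. -/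
open MeasureTheory Real

/-- Conditional Jensen inequality for the exponential. -/
theorem exp_condExp_le {Ω : Type*} {F : MeasurableSpace Ω} {μ : Measure Ω}
    [IsFiniteMeasure μ] {G : MeasurableSpace Ω} (hG : G ≤ F) {X : Ω → ℝ}
    (hX : Integrable X μ) (hexp : Integrable (fun ω => exp (X ω)) μ) :
    ∀ᵐ ω ∂μ, exp ((μ[X|G]) ω) ≤ (μ[fun ω' => exp (X ω')|G]) ω :=
  convexOn_exp.map_condExp_le_univ hG continuous_exp.lowerSemicontinuous hX hexp

/-- Conditioning decreases exponential moments, as an inequality in `[0, ∞]`. -/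
theorem lintegral_exp_condExp_le {Ω : Type*} {F : MeasurableSpace Ω} {μ : Measure Ω}
    [IsFiniteMeasure μ] {G : MeasurableSpace Ω} (hG : G ≤ F) {X : Ω → ℝ}
    (hX : Integrable X μ) :
    ∫⁻ ω, ENNReal.ofReal (exp ((μ[X|G]) ω)) ∂μ ≤ ∫⁻ ω, ENNReal.ofReal (exp (X ω)) ∂μ := by
  by_cases hexp : Integrable (fun ω => exp (X ω)) μ
  · have h_nonneg : 0 ≤ᵐ[μ] μ[fun ω => exp (X ω)|G] :=
      condExp_nonneg (ae_of_all _ fun ω => (exp_pos _).le)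
    calc ∫⁻ ω, ENNReal.ofReal (exp ((μ[X|G]) ω)) ∂μ
        ≤ ∫⁻ ω, ENNReal.ofReal ((μ[fun ω' => exp (X ω')|G]) ω) ∂μ := by
          apply lintegral_mono_ae
          filter_upwards [exp_condExp_le hG hX hexp] with ω h
          exact ENNReal.ofReal_le_ofReal h
      _ = ∫⁻ ω, ENNReal.ofReal (exp (X ω)) ∂μ := by
          rw [← ofReal_integral_eq_lintegral_ofReal integrable_condExp h_nonneg,
            ← ofReal_integral_eq_lintegral_ofReal hexp (ae_of_all _ fun ω => (exp_pos _).le),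
            integral_condExp hG]
  · have h_top : ∫⁻ ω, ENNReal.ofReal (exp (X ω)) ∂μ = ⊤ := by
      by_contra h
      exact hexp ((lintegral_ofReal_ne_top_iff_integrable
        (continuous_exp.comp_aestronglyMeasurable hX.1)
        (ae_of_all _ fun ω => (exp_pos _).le)).1 h)
    simp [h_top]

/-- If `S` and `log S` are integrable, then so is the logarithm of `E[S | G]`. -/
theorem integrable_log_condExp {Ω : Type*} {F : MeasurableSpace Ω} {μ : Measure Ω}
    [IsFiniteMeasure μ] {G : MeasurableSpace Ω} (hG : G ≤ F) {S : Ω → ℝ}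
    (hSpos : ∀ᵐ ω ∂μ, 0 < S ω) (hSint : Integrable S μ)
    (hlogint : Integrable (fun ω => log (S ω)) μ) (hcond : ∀ᵐ ω ∂μ, 0 < (μ[S|G]) ω) :
    Integrable (fun ω => log ((μ[S|G]) ω)) μ := by
  have hexp : (fun ω => exp (log (S ω))) =ᵐ[μ] S := by
    filter_upwards [hSpos] with ω h using exp_log h
  refine integrable_of_le_of_le
    (measurable_log.comp_aemeasurable integrable_condExp.aemeasurable).aestronglyMeasurable
    ?_ ?_ (integrable_condExp (f := fun ω => log (S ω)) (m := G))
    (integrable_condExp (f := S) (m := G))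
  · filter_upwards [exp_condExp_le hG hlogint (hSint.congr hexp.symm),
      condExp_congr_ae (m := G) hexp, hcond] with ω h h_eq h_pos
    rw [h_eq] at h
    exact (le_log_iff_exp_le h_pos).2 h
  · filter_upwards [hcond] with ω h
    exact log_le_self h.le

/-- Abstract form of the MGF bound (Lemma 3.2): for `S > 0` a.s. with `S`, `log S`
integrable and a.s. positive conditional expectation `E[S | G]`, setting
`V² = -(2/τ)·E[log(S / E[S|G]) | G]`, for every `ξ` and conjugate exponents `p, q`,
`E[exp(ξ V²)] ≤ (1/q)·E[S^(-2ξq/τ)] + (1/p)·E[(E[S|G])^(2ξp/τ)]` in `[0, ∞]`. -/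
theorem mgf_bound
    {Ω : Type*} {F : MeasurableSpace Ω} {μ : Measure Ω} [IsProbabilityMeasure μ]
    {G : MeasurableSpace Ω} (hG : G ≤ F)
    (S : Ω → ℝ) (hSmeas : Measurable S)
    (hSpos : ∀ᵐ ω ∂μ, 0 < S ω)
    (hSint : Integrable S μ)
    (hlogint : Integrable (fun ω => Real.log (S ω)) μ)
    (hcond : ∀ᵐ ω ∂μ, 0 < (μ[S|G]) ω)
    (τ : ℝ) (hτ : 0 < τ)
    (V2 : Ω → ℝ)
    (hV2 : ∀ ω, V2 ω = -(2 / τ) * (μ[fun ω' => Real.log (S ω' / (μ[S|G]) ω')|G]) ω)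
    (ξ p q : ℝ) (hp : 1 < p) (hq : 1 < q) (hpq : 1 / p + 1 / q = 1) :
    (∫⁻ ω, ENNReal.ofReal (Real.exp (ξ * V2 ω)) ∂μ) ≤
      ENNReal.ofReal (1 / q) * ∫⁻ ω, ENNReal.ofReal (S ω ^ (-(2 * ξ * q) / τ)) ∂μ +
      ENNReal.ofReal (1 / p) * ∫⁻ ω, ENNReal.ofReal ((μ[S|G]) ω ^ (2 * ξ * p / τ)) ∂μ := by
  have hlogY := integrable_log_condExp hG hSpos hSint hlogint hcond
  have hV : ∀ᵐ ω ∂μ, V2 ω =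
      -(2 / τ) * ((μ[fun ω' => log (S ω')|G]) ω - log ((μ[S|G]) ω)) := by
    have h_log : (fun ω => log (S ω / (μ[S|G]) ω)) =ᵐ[μ]
        (fun ω => log (S ω)) - fun ω => log ((μ[S|G]) ω) := by
      filter_upwards [hSpos, hcond] with ω hS hY using log_div hS.ne' hY.ne'
    have h_meas : StronglyMeasurable[G] fun ω => log ((μ[S|G]) ω) :=
      (measurable_log.comp stronglyMeasurable_condExp.measurable).stronglyMeasurable
    filter_upwards [condExp_congr_ae (m := G) h_log, condExp_sub hlogint hlogY G] with ω h₁ h₂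
    rw [hV2, h₁, h₂, Pi.sub_apply, condExp_of_stronglyMeasurable hG h_meas hlogY]
  have h_conj : q.HolderConjugate p :=
    Real.holderConjugate_iff.2 ⟨hq, by simpa [add_comm] using hpq⟩
  have hp0 : 0 < p := by linarith
  have hq0 : 0 < q := by linarith
  set c : ℝ := -(2 * ξ * q) / τ with hc
  have h_young : ∀ᵐ ω ∂μ, ENNReal.ofReal (exp (ξ * V2 ω)) ≤
      ENNReal.ofReal (1 / q) * ENNReal.ofReal (exp ((μ[fun ω' => c * log (S ω')|G]) ω)) +
      ENNReal.ofReal (1 / p) * ENNReal.ofReal ((μ[S|G]) ω ^ (2 * ξ * p / τ)) := by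
    filter_upwards [hV, hcond, condExp_smul (μ := μ) c (fun ω => log (S ω)) G] with ω hVω hY h_smul
    have h_smul' : (μ[fun ω' => c * log (S ω')|G]) ω =
        c * (μ[fun ω' => log (S ω')|G]) ω := h_smul
    rw [h_smul', ← ENNReal.ofReal_mul (by positivity), ← ENNReal.ofReal_mul (by positivity),
      ← ENNReal.ofReal_add (by positivity) (by positivity)]
    apply ENNReal.ofReal_le_ofReal
    rw [hVω, rpow_def_of_pos hY]
    set L := (μ[fun ω' => log (S ω')|G]) ω
    set Y := log ((μ[S|G]) ω)
    have h := Real.young_inequality_of_nonneg (exp_pos (-(2 * ξ / τ) * L)).le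
      (exp_pos (2 * ξ / τ * Y)).le h_conj
    rw [← exp_add, ← exp_mul, ← exp_mul] at h
    convert h using 1
    · congr 1
      ring
    · rw [hc, show -(2 * ξ / τ) * L * q = -(2 * ξ * q) / τ * L by ring,
        show 2 * ξ / τ * Y * p = Y * (2 * ξ * p / τ) by ring]
      ring
  have h_jensen : ∫⁻ ω, ENNReal.ofReal (exp ((μ[fun ω' => c * log (S ω')|G]) ω)) ∂μ ≤
      ∫⁻ ω, ENNReal.ofReal (S ω ^ c) ∂μ := by
    refine (lintegral_exp_condExp_le hG (hlogint.const_mul c)).trans_eq (lintegral_congr_ae ?_)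
    filter_upwards [hSpos] with ω h
    rw [rpow_def_of_pos h, mul_comm]
  have h_meas : AEMeasurable
      (fun ω => ENNReal.ofReal (exp ((μ[fun ω' => c * log (S ω')|G]) ω))) μ :=
    (measurable_exp.comp_aemeasurable integrable_condExp.aemeasurable).ennreal_ofReal
  refine (lintegral_mono_ae h_young).trans ?_
  rw [lintegral_add_left' (h_meas.const_mul _), lintegral_const_mul' _ _ ENNReal.ofReal_ne_top,
    lintegral_const_mul' _ _ ENNReal.ofReal_ne_top]
  gcongr
end

section
/- Let V be a nonnegative random variable on a probability space and let ξ > 0. Then the following equality holds in the extended nonnegative reals [0, ∞]: E[exp(ξ·V²)] = 1 + ∫₀^∞ (2ξ + 4ξ²K²)·e^(ξ·K²)·E[max(V − K, 0)] dK. In particular, E[exp(ξ·V²)] < ∞ if and only if ∫₀^∞ (2ξ + 4ξ²K²)·e^(ξ·K²)·E[max(V − K, 0)] dK < ∞. -/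
open MeasureTheory Real

/-- The Taylor formula with integral remainder for `K ↦ exp (ξ * K ^ 2)` on `[0, v]`. -/
theorem integral_exp_mul_sq_remainder (ξ v : ℝ) :
    ∫ K in (0 : ℝ)..v, (2 * ξ + 4 * ξ ^ 2 * K ^ 2) * Real.exp (ξ * K ^ 2) * (v - K) =
      Real.exp (ξ * v ^ 2) - 1 := by
  have hderiv : ∀ K : ℝ, HasDerivAt
      (fun K => 2 * ξ * K * Real.exp (ξ * K ^ 2) * (v - K) + Real.exp (ξ * K ^ 2))
      ((2 * ξ + 4 * ξ ^ 2 * K ^ 2) * Real.exp (ξ * K ^ 2) * (v - K)) K := by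
    intro K
    have hexp : HasDerivAt (fun K => Real.exp (ξ * K ^ 2))
        (Real.exp (ξ * K ^ 2) * (ξ * (2 * K))) K := by
      simpa using ((hasDerivAt_pow 2 K).const_mul ξ).exp
    have hlin : HasDerivAt (fun K : ℝ => 2 * ξ * K) (2 * ξ) K := by
      simpa using (hasDerivAt_id K).const_mul (2 * ξ)
    refine HasDerivAt.congr_deriv
      (((hlin.mul hexp).mul ((hasDerivAt_id K).const_sub v)).add hexp) ?_
    simp only [Pi.mul_apply, id]
    ring
  rw [intervalIntegral.integral_eq_sub_of_hasDerivAt (fun K _ => hderiv K)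
    (Continuous.intervalIntegrable (by fun_prop) _ _)]
  simp

/-- Replication of `exp (ξ * v ^ 2)` by call payoffs `max (v - K) 0`. -/
theorem ofReal_exp_mul_sq_eq_lintegral_call {ξ v : ℝ} (hξ : 0 ≤ ξ) (hv : 0 ≤ v) :
    ENNReal.ofReal (Real.exp (ξ * v ^ 2)) =
      1 + ∫⁻ K in Set.Ioi (0 : ℝ),
        ENNReal.ofReal ((2 * ξ + 4 * ξ ^ 2 * K ^ 2) * Real.exp (ξ * K ^ 2)) *
          ENNReal.ofReal (max (v - K) 0) := by
  have hsplit : ∫⁻ K in Set.Ioi (0 : ℝ),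
      ENNReal.ofReal ((2 * ξ + 4 * ξ ^ 2 * K ^ 2) * Real.exp (ξ * K ^ 2)) *
        ENNReal.ofReal (max (v - K) 0) =
      ∫⁻ K in Set.Ioc 0 v, ENNReal.ofReal
        ((2 * ξ + 4 * ξ ^ 2 * K ^ 2) * Real.exp (ξ * K ^ 2) * (v - K)) := by
    rw [← Set.Ioc_union_Ioi_eq_Ioi hv, lintegral_union measurableSet_Ioi
      (Set.Ioc_disjoint_Ioi le_rfl), setLIntegral_eq_zero (s := Set.Ioi v) measurableSet_Ioi,
      add_zero]
    · refine setLIntegral_congr_fun measurableSet_Ioc fun K hK => ?_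
      rw [max_eq_left (sub_nonneg.2 hK.2), ← ENNReal.ofReal_mul (by positivity)]
    · intro K hK
      simp [max_eq_right (sub_nonpos.2 (le_of_lt (Set.mem_Ioi.1 hK)))]
  have hint : IntegrableOn
      (fun K => (2 * ξ + 4 * ξ ^ 2 * K ^ 2) * Real.exp (ξ * K ^ 2) * (v - K)) (Set.Ioc 0 v) :=
    Continuous.integrableOn_Ioc (by fun_prop)
  have hone : 1 ≤ Real.exp (ξ * v ^ 2) := Real.one_le_exp (by positivity)
  rw [hsplit, ← ofReal_integral_eq_lintegral_ofReal hint, ← intervalIntegral.integral_of_le hv,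
    integral_exp_mul_sq_remainder, ← ENNReal.ofReal_one,
    ← ENNReal.ofReal_add zero_le_one (sub_nonneg.2 hone), add_sub_cancel]
  filter_upwards [ae_restrict_mem measurableSet_Ioc] with K hK
  exact mul_nonneg (by positivity) (sub_nonneg.2 hK.2)

/-- Expectation form of Proposition 3.4 (replication of the VIX MGF by call options):
for a nonnegative random variable `V` and `ξ > 0`, in `[0, ∞]`,
`E[exp(ξ V²)] = 1 + ∫₀^∞ (2ξ + 4ξ²K²) e^(ξ K²) E[(V - K)⁺] dK`,
and in particular the left side is finite iff the strike integral is finite. -/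
theorem mgf_call_replication
    {Ω : Type*} [MeasurableSpace Ω] (μ : Measure Ω) [IsProbabilityMeasure μ]
    (V : Ω → ℝ) (hVmeas : Measurable V) (hVpos : ∀ ω, 0 ≤ V ω)
    (ξ : ℝ) (hξ : 0 < ξ) :
    (∫⁻ ω, ENNReal.ofReal (Real.exp (ξ * V ω ^ 2)) ∂μ) =
      1 + ∫⁻ K in Set.Ioi (0 : ℝ),
        ENNReal.ofReal ((2 * ξ + 4 * ξ ^ 2 * K ^ 2) * Real.exp (ξ * K ^ 2)) *
          (∫⁻ ω, ENNReal.ofReal (max (V ω - K) 0) ∂μ) ∧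
    ((∫⁻ ω, ENNReal.ofReal (Real.exp (ξ * V ω ^ 2)) ∂μ) < ⊤ ↔
      (∫⁻ K in Set.Ioi (0 : ℝ),
        ENNReal.ofReal ((2 * ξ + 4 * ξ ^ 2 * K ^ 2) * Real.exp (ξ * K ^ 2)) *
          (∫⁻ ω, ENNReal.ofReal (max (V ω - K) 0) ∂μ)) < ⊤) := by
  have key : (∫⁻ ω, ENNReal.ofReal (Real.exp (ξ * V ω ^ 2)) ∂μ) =
      1 + ∫⁻ K in Set.Ioi (0 : ℝ),
        ENNReal.ofReal ((2 * ξ + 4 * ξ ^ 2 * K ^ 2) * Real.exp (ξ * K ^ 2)) *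
          (∫⁻ ω, ENNReal.ofReal (max (V ω - K) 0) ∂μ) := by
    simp_rw [fun ω => ofReal_exp_mul_sq_eq_lintegral_call hξ.le (hVpos ω)]
    rw [lintegral_add_left measurable_const, lintegral_one, measure_univ,
      lintegral_lintegral_swap (by unfold Function.uncurry; fun_prop)]
    congr 1
    refine lintegral_congr fun K => ?_
    rw [lintegral_const_mul _ (by fun_prop)]
  exact ⟨key, by simp [key, ENNReal.add_lt_top]⟩
end

section
/- For all real numbers s > 0 and s* > 0, the following identity holds: −log(s/s*) = −(s − s*)/s* + ∫₀^{s*} max(K − s, 0)/K² dK + ∫_{s*}^∞ max(s − K, 0)/K² dK, where both integrals are finite. -/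
open MeasureTheory Real

lemma intervalIntegrable_sub_div_sq (s : ℝ) {a b : ℝ} (ha : 0 < a) (hb : 0 < b) :
    IntervalIntegrable (fun K : ℝ => (K - s) / K ^ 2) volume a b := by
  apply ContinuousOn.intervalIntegrable
  intro x hx
  have hx0 : 0 < x := lt_of_lt_of_le (lt_min ha hb) hx.1
  have : x ^ 2 ≠ 0 := by positivity
  exact ContinuousAt.continuousWithinAt (by fun_prop (disch := assumption))

lemma integral_sub_div_sq (s : ℝ) {a b : ℝ} (ha : 0 < a) (hb : 0 < b) :
    ∫ K in a..b, (K - s) / K ^ 2 = (log b + s / b) - (log a + s / a) := by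
  refine intervalIntegral.integral_eq_sub_of_hasDerivAt (f := fun K => log K + s / K) ?_
    (intervalIntegrable_sub_div_sq s ha hb)
  intro x hx
  have hx0 : x ≠ 0 := (lt_of_lt_of_le (lt_min ha hb) hx.1).ne'
  refine ((hasDerivAt_log hx0).add
    ((hasDerivAt_const x s).div (hasDerivAt_id x) hx0)).congr_deriv ?_
  simp only [id]
  field_simp
  ring

lemma put_payoff_eq_indicator (s b : ℝ) :
    Set.EqOn (fun K : ℝ => max (K - s) 0 / K ^ 2)
      ((Set.Ioc s b).indicator fun K => (K - s) / K ^ 2) (Set.Ioc 0 b) := by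
  intro K hK
  by_cases h : s < K
  · simp [Set.indicator, h, hK.2, max_eq_left (sub_pos.2 h).le]
  · simp [Set.indicator, h, max_eq_right (sub_nonpos.2 (not_lt.1 h))]

lemma call_payoff_eq_indicator (s a : ℝ) :
    Set.EqOn (fun K : ℝ => max (s - K) 0 / K ^ 2)
      ((Set.Ioc a s).indicator fun K => -((K - s) / K ^ 2)) (Set.Ioi a) := by
  intro K hK
  have hK : a < K := hK
  by_cases h : K ≤ s
  · simp [Set.indicator, h, hK, ← neg_div]
  · simp [Set.indicator, h, (not_le.1 h).le]

/-- Static replication identity for the negative log contract (used to derive the VIX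
formula): for `s, s* > 0`,
`-log(s/s*) = -(s - s*)/s* + ∫₀^{s*} (K - s)⁺/K² dK + ∫_{s*}^∞ (s - K)⁺/K² dK`,
and both integrals are finite. -/
theorem neg_log_contract_replication (s sstar : ℝ) (hs : 0 < s) (hsstar : 0 < sstar) :
    (-Real.log (s / sstar) =
      -((s - sstar) / sstar) +
        (∫ K in Set.Ioc (0 : ℝ) sstar, max (K - s) 0 / K ^ 2) +
        (∫ K in Set.Ioi sstar, max (s - K) 0 / K ^ 2)) ∧
    IntegrableOn (fun K : ℝ => max (K - s) 0 / K ^ 2) (Set.Ioc 0 sstar) ∧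
    IntegrableOn (fun K : ℝ => max (s - K) 0 / K ^ 2) (Set.Ioi sstar) := by
  have hint := intervalIntegrable_sub_div_sq s hs hsstar
  have hput := put_payoff_eq_indicator s sstar
  have hcall := call_payoff_eq_indicator s sstar
  refine ⟨?_, ?_, ?_⟩
  · have hput_sub : Set.Ioc 0 sstar ∩ Set.Ioc s sstar = Set.Ioc s sstar :=
      Set.inter_eq_right.2 (Set.Ioc_subset_Ioc_left hs.le)
    have hcall_sub : Set.Ioi sstar ∩ Set.Ioc sstar s = Set.Ioc sstar s :=
      Set.inter_eq_right.2 fun K hK => hK.1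
    have hval := integral_sub_div_sq s hs hsstar
    rw [setIntegral_congr_fun measurableSet_Ioc hput,
      setIntegral_congr_fun measurableSet_Ioi hcall,
      setIntegral_indicator measurableSet_Ioc, setIntegral_indicator measurableSet_Ioc,
      hput_sub, hcall_sub, integral_neg, add_assoc, ← sub_eq_add_neg,
      ← intervalIntegral, hval, log_div hs.ne' hsstar.ne']
    field_simp
    ring
  · rw [integrableOn_congr_fun hput measurableSet_Ioc]
    exact (hint.1.integrable_indicator measurableSet_Ioc).integrableOn
  · rw [integrableOn_congr_fun hcall measurableSet_Ioi]
    exact (hint.2.neg.integrable_indicator measurableSet_Ioc).integrableOn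
end

section
/- Let S be a random variable with S > 0 almost surely, let q > 0, and let F > 0. Then ∫₀^F K^(−2)·E[max(K − S, 0)] dK ≤ (1/(q(q+1)))·(q/(q+1))^q·F^q·E[S^(−q)], where both sides take values in [0, ∞]. In particular, if E[S^(−q)] < ∞ for some q > 0, then the strike-integrated put portfolio ∫₀^F K^(−2)·E[max(K − S, 0)] dK is finite. -/
open MeasureTheory Real

/-- The pointwise put bound: the payoff `(K - s)⁺` is dominated by a multiple of `s ^ (-q)`. -/
lemma max_sub_zero_le_mul_rpow_neg {q K s : ℝ} (hq : 0 < q) (hK : 0 < K) (hs : 0 < s) :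
    max (K - s) 0 ≤ (q / (q + 1)) ^ q / (q + 1) * K ^ (q + 1) * s ^ (-q) := by
  refine max_le ?_ (by positivity)
  set u := s / (q / (q + 1) * K) with hu
  have hu0 : 0 < u := by positivity
  have tangent : 1 - q * (u - 1) ≤ u ^ (-q) := by
    rw [rpow_def_of_pos hu0]
    nlinarith [log_le_sub_one_of_pos hu0, add_one_le_exp (log u * -q)]
  have hpow : u ^ (-q) = (q / (q + 1)) ^ q * K ^ q * s ^ (-q) := by
    rw [hu, div_rpow hs.le (by positivity), mul_rpow (by positivity) hK.le,
      rpow_neg (x := q / (q + 1)) (by positivity), rpow_neg hK.le]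
    field_simp
  calc K - s = K / (q + 1) * (1 - q * (u - 1)) := by rw [hu]; field_simp; ring
    _ ≤ K / (q + 1) * u ^ (-q) := by gcongr
    _ = _ := by rw [hpow, rpow_add_one hK.ne']; ring

/-- The integral of the power `x ^ (q - 1)` over `(0, F]`, in `[0, ∞]`. -/
lemma lintegral_Ioc_ofReal_rpow_sub_one {q F : ℝ} (hq : 0 < q) (hF : 0 ≤ F) :
    ∫⁻ x in Set.Ioc (0 : ℝ) F, ENNReal.ofReal (x ^ (q - 1)) = ENNReal.ofReal (F ^ q / q) := by
  have hint : IntervalIntegrable (fun x : ℝ => x ^ (q - 1)) volume 0 F :=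
    intervalIntegral.intervalIntegrable_rpow' (by linarith)
  rw [← ofReal_integral_eq_lintegral_ofReal
      ((intervalIntegrable_iff_integrableOn_Ioc_of_le hF).1 hint)
      ((ae_restrict_mem measurableSet_Ioc).mono fun x hx => rpow_nonneg hx.1.le _),
    ← intervalIntegral.integral_of_le hF, integral_rpow (Or.inl (by linarith))]
  simp [zero_rpow hq.ne']

/-- Strike-integrated put portfolio bound (key estimate of Proposition 3.1): for `S > 0`
a.s., `q > 0` and `F > 0`,
`∫₀^F K^(-2) E[(K - S)⁺] dK ≤ (1/(q(q+1)))(q/(q+1))^q F^q E[S^(-q)]` in `[0, ∞]`;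
in particular, if `E[S^(-q)] < ∞` for some `q > 0`, the put portfolio is finite. -/
theorem put_portfolio_bound
    {Ω : Type*} [MeasurableSpace Ω] (μ : Measure Ω) [IsProbabilityMeasure μ]
    (S : Ω → ℝ) (hSmeas : Measurable S) (hSpos : ∀ᵐ ω ∂μ, 0 < S ω)
    (q : ℝ) (hq : 0 < q) (F : ℝ) (hF : 0 < F) :
    (∫⁻ K in Set.Ioc (0 : ℝ) F,
        ENNReal.ofReal (1 / K ^ 2) * (∫⁻ ω, ENNReal.ofReal (max (K - S ω) 0) ∂μ)) ≤
      ENNReal.ofReal (1 / (q * (q + 1)) * (q / (q + 1)) ^ q * F ^ q) *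
        (∫⁻ ω, ENNReal.ofReal (S ω ^ (-q)) ∂μ) ∧
    ((∫⁻ ω, ENNReal.ofReal (S ω ^ (-q)) ∂μ) < ⊤ →
      (∫⁻ K in Set.Ioc (0 : ℝ) F,
        ENNReal.ofReal (1 / K ^ 2) * (∫⁻ ω, ENNReal.ofReal (max (K - S ω) 0) ∂μ)) < ⊤) := by
  have key : (∫⁻ K in Set.Ioc (0 : ℝ) F,
        ENNReal.ofReal (1 / K ^ 2) * (∫⁻ ω, ENNReal.ofReal (max (K - S ω) 0) ∂μ)) ≤
      ENNReal.ofReal (1 / (q * (q + 1)) * (q / (q + 1)) ^ q * F ^ q) *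
        (∫⁻ ω, ENNReal.ofReal (S ω ^ (-q)) ∂μ) := by
    set M := ∫⁻ ω, ENNReal.ofReal (S ω ^ (-q)) ∂μ
    set C := (q / (q + 1)) ^ q / (q + 1) with hC
    have hC0 : 0 ≤ C := by positivity
    calc (∫⁻ K in Set.Ioc (0 : ℝ) F,
          ENNReal.ofReal (1 / K ^ 2) * (∫⁻ ω, ENNReal.ofReal (max (K - S ω) 0) ∂μ))
        ≤ ∫⁻ K in Set.Ioc (0 : ℝ) F, ENNReal.ofReal C * M * ENNReal.ofReal (K ^ (q - 1)) := by
          refine setLIntegral_mono (by fun_prop) fun K hK => ?_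
          have hK0 : 0 < K := hK.1
          calc ENNReal.ofReal (1 / K ^ 2) * (∫⁻ ω, ENNReal.ofReal (max (K - S ω) 0) ∂μ)
              ≤ ENNReal.ofReal (1 / K ^ 2) * (ENNReal.ofReal (C * K ^ (q + 1)) * M) := by
                gcongr
                rw [← lintegral_const_mul _ (by fun_prop)]
                refine lintegral_mono_ae (hSpos.mono fun ω hω => ?_)
                rw [← ENNReal.ofReal_mul (by positivity)]
                exact ENNReal.ofReal_le_ofReal (max_sub_zero_le_mul_rpow_neg hq hK0 hω)
            _ = ENNReal.ofReal C * M * ENNReal.ofReal (K ^ (q - 1)) := by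
                have hpow : 1 / K ^ 2 * (C * K ^ (q + 1)) = C * K ^ (q - 1) := by
                  rw [rpow_add_one hK0.ne', rpow_sub_one hK0.ne']
                  field_simp
                rw [← mul_assoc, ← ENNReal.ofReal_mul (by positivity), hpow,
                  ENNReal.ofReal_mul hC0, mul_right_comm]
      _ = ENNReal.ofReal (1 / (q * (q + 1)) * (q / (q + 1)) ^ q * F ^ q) * M := by
          rw [lintegral_const_mul _ (by fun_prop), lintegral_Ioc_ofReal_rpow_sub_one hq hF.le,
            mul_right_comm, ← ENNReal.ofReal_mul hC0]
          congr 2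
          rw [hC]
          field_simp
  exact ⟨key, fun h => key.trans_lt (ENNReal.mul_lt_top ENNReal.ofReal_lt_top h)⟩
end

section
/- Let a, m ∈ ℝ, b > 0, σ > 0 and ρ ∈ (−1, 1), and define the SVI total variance function ω(k) = a + b·(ρ(k − m) + √((k − m)² + σ²)). Set β = b(1 + ρ) and assume 0 < β < 2 and that ω(k) > 0 for all sufficiently large k. Define g(k) = (1 − k·ω′(k)/(2ω(k)))² − (ω′(k))²/4 · (1/ω(k) + 1/4) + ω″(k)/2. Then lim_{k → ∞} g(k) = 1/4 − β²/16, and this limit is strictly positive. -/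
open Real Filter

theorem hasDerivAt_sqrt_sub_sq_add_sq {σ : ℝ} (hσ : 0 < σ) (m k : ℝ) :
    HasDerivAt (fun k => √((k - m) ^ 2 + σ ^ 2)) ((k - m) / √((k - m) ^ 2 + σ ^ 2)) k := by
  have hlin : HasDerivAt (fun k : ℝ => k - m) 1 k := (hasDerivAt_id k).sub_const m
  have hpos : 0 < (k - m) ^ 2 + σ ^ 2 := by positivity
  refine (((hlin.pow 2).add_const (σ ^ 2)).sqrt hpos.ne').congr_deriv ?_
  have := (Real.sqrt_pos.2 hpos).ne'
  simp only [Pi.pow_apply]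
  field_simp
  norm_num [mul_comm]

theorem hasDerivAt_sub_div_sqrt_sub_sq_add_sq {σ : ℝ} (hσ : 0 < σ) (m k : ℝ) :
    HasDerivAt (fun k => (k - m) / √((k - m) ^ 2 + σ ^ 2))
      ((√((k - m) ^ 2 + σ ^ 2))⁻¹ * (1 - ((k - m) / √((k - m) ^ 2 + σ ^ 2)) ^ 2)) k := by
  have hlin : HasDerivAt (fun k : ℝ => k - m) 1 k := (hasDerivAt_id k).sub_const m
  have hS : √((k - m) ^ 2 + σ ^ 2) ≠ 0 := (Real.sqrt_pos.2 (by positivity)).ne'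
  refine (hlin.div (hasDerivAt_sqrt_sub_sq_add_sq hσ m k) hS).congr_deriv ?_
  generalize √((k - m) ^ 2 + σ ^ 2) = S at hS
  field_simp

theorem tendsto_sqrt_sub_sq_add_sq_atTop (m σ : ℝ) :
    Tendsto (fun k : ℝ => √((k - m) ^ 2 + σ ^ 2)) atTop atTop :=
  tendsto_atTop_mono
    (fun k => Real.le_sqrt_of_sq_le (by simp only [id]; nlinarith [sq_nonneg σ]))
    (tendsto_atTop_add_const_right _ (-m) tendsto_id)

theorem tendsto_sqrt_sub_sq_add_sq_sub_self (m σ : ℝ) :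
    Tendsto (fun k : ℝ => √((k - m) ^ 2 + σ ^ 2) - (k - m)) atTop (nhds 0) := by
  have hbound : Tendsto (fun k : ℝ => σ ^ 2 * (√((k - m) ^ 2 + σ ^ 2))⁻¹) atTop (nhds 0) := by
    simpa using (tendsto_sqrt_sub_sq_add_sq_atTop m σ).inv_tendsto_atTop.const_mul (σ ^ 2)
  refine tendsto_of_tendsto_of_tendsto_of_le_of_le' tendsto_const_nhds hbound ?_ ?_
  · exact Eventually.of_forall fun k =>
      sub_nonneg.2 (Real.le_sqrt_of_sq_le (by nlinarith [sq_nonneg σ]))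
  · filter_upwards [eventually_gt_atTop m] with k hk
    have hx : 0 < k - m := sub_pos.2 hk
    have hpos : 0 < (k - m) ^ 2 + σ ^ 2 := by positivity
    have hsq := Real.sq_sqrt hpos.le
    have hle : k - m ≤ √((k - m) ^ 2 + σ ^ 2) :=
      Real.le_sqrt_of_sq_le (by nlinarith [sq_nonneg σ])
    rw [← div_eq_mul_inv, le_div_iff₀ (Real.sqrt_pos.2 hpos)]
    nlinarith

theorem tendsto_sub_div_sqrt_sub_sq_add_sq {σ : ℝ} (hσ : 0 < σ) (m : ℝ) :
    Tendsto (fun k : ℝ => (k - m) / √((k - m) ^ 2 + σ ^ 2)) atTop (nhds 1) := by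
  have h := ((tendsto_sqrt_sub_sq_add_sq_sub_self m σ).mul
    (tendsto_sqrt_sub_sq_add_sq_atTop m σ).inv_tendsto_atTop).const_sub 1
  simp only [mul_zero, sub_zero] at h
  refine h.congr fun k => ?_
  have hS : √((k - m) ^ 2 + σ ^ 2) ≠ 0 := (Real.sqrt_pos.2 (by positivity)).ne'
  simp only [Pi.inv_apply]
  field_simp
  ring

/-- Large log-strike limit of the SVI no-butterfly-arbitrage density factor `g`
(Proposition 3.8): with `ω(k) = a + b(ρ(k-m) + √((k-m)² + σ²))`, `β = b(1+ρ) ∈ (0,2)`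
and `ω > 0` for large `k`, the factor `g(k)` tends to `1/4 - β²/16 > 0`. -/
theorem svi_density_factor_limit
    (a m b σ ρ : ℝ) (hb : 0 < b) (hσ : 0 < σ) (hρ1 : -1 < ρ) (hρ2 : ρ < 1)
    (w : ℝ → ℝ)
    (hw : ∀ k, w k = a + b * (ρ * (k - m) + Real.sqrt ((k - m) ^ 2 + σ ^ 2)))
    (β : ℝ) (hβ : β = b * (1 + ρ)) (hβ0 : 0 < β) (hβ2 : β < 2)
    (hwpos : ∀ᶠ k in atTop, 0 < w k)
    (g : ℝ → ℝ)
    (hg : ∀ k, g k =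
      (1 - k * deriv w k / (2 * w k)) ^ 2 -
        (deriv w k) ^ 2 / 4 * (1 / w k + 1 / 4) + deriv (deriv w) k / 2) :
    Tendsto g atTop (nhds (1 / 4 - β ^ 2 / 16)) ∧ 0 < 1 / 4 - β ^ 2 / 16 := by
  have hderiv : deriv w = fun k => b * (ρ + (k - m) / √((k - m) ^ 2 + σ ^ 2)) := by
    rw [funext hw]
    funext k
    have hlin : HasDerivAt (fun k : ℝ => k - m) 1 k := (hasDerivAt_id k).sub_const m
    have h := (((hlin.const_mul ρ).add (hasDerivAt_sqrt_sub_sq_add_sq hσ m k)).const_mul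
      b).const_add a
    rw [mul_one] at h
    exact h.deriv
  have hderiv2 : deriv (deriv w) = fun k => b * ((√((k - m) ^ 2 + σ ^ 2))⁻¹ *
      (1 - ((k - m) / √((k - m) ^ 2 + σ ^ 2)) ^ 2)) := by
    rw [hderiv]
    funext k
    exact (((hasDerivAt_sub_div_sqrt_sub_sq_add_sq hσ m k).const_add ρ).const_mul b).deriv
  have hratio := tendsto_sub_div_sqrt_sub_sq_add_sq hσ m
  have hinv : Tendsto (fun k : ℝ => k⁻¹) atTop (nhds 0) := tendsto_inv_atTop_zero
  have hw1 : Tendsto (deriv w) atTop (nhds β) := by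
    rw [hderiv, hβ, add_comm 1 ρ]
    exact (hratio.const_add ρ).const_mul b
  have hw2 : Tendsto (deriv (deriv w)) atTop (nhds 0) := by
    rw [hderiv2]
    simpa using ((tendsto_sqrt_sub_sq_add_sq_atTop m σ).inv_tendsto_atTop.mul
      ((hratio.pow 2).const_sub 1)).const_mul b
  have hslope : Tendsto (fun k => w k / k) atTop (nhds β) := by
    have h := ((((tendsto_sqrt_sub_sq_add_sq_sub_self m σ).const_mul b).const_add
      (a - β * m)).mul hinv).const_add β
    simp only [mul_zero, add_zero] at h
    refine h.congr' ?_
    filter_upwards [eventually_ne_atTop 0] with k hk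
    rw [hw, hβ]
    field_simp
    ring
  have hfirst : Tendsto (fun k => k * deriv w k / (2 * w k)) atTop (nhds (1 / 2)) := by
    have h := hw1.div (hslope.const_mul 2) (by positivity)
    rw [show β / (2 * β) = 1 / 2 by field_simp] at h
    refine h.congr' ?_
    filter_upwards [eventually_ne_atTop 0, hwpos] with k hk hwk
    simp only [Pi.div_apply]
    field_simp
  have hwinv : Tendsto (fun k => 1 / w k) atTop (nhds 0) := by
    have h := hinv.div hslope hβ0.ne'
    rw [zero_div] at h
    refine h.congr' ?_
    filter_upwards [eventually_ne_atTop 0, hwpos] with k hk hwk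
    simp only [Pi.div_apply]
    field_simp
  refine ⟨?_, by nlinarith⟩
  rw [funext hg]
  convert (((hfirst.const_sub 1).pow 2).sub (((hw1.pow 2).div_const 4).mul
    (hwinv.add_const (1 / 4)))).add (hw2.div_const 2) using 2
  ring
end

section
/- For every x with 0 < x < 1, the Dawson-type inequality e^(−x²)·∫₀^x e^(u²) du > x − (2/3)·x³ holds. -/
open Real intervalIntegral

lemma hasDerivAt_integral_exp_sq_sub (t : ℝ) :
    HasDerivAt (fun y : ℝ => (∫ u in (0 : ℝ)..y, Real.exp (u ^ 2))
      - (y - 2 / 3 * y ^ 3) * Real.exp (y ^ 2)) (4 / 3 * t ^ 4 * Real.exp (t ^ 2)) t := by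
  have hc : Continuous fun u : ℝ => Real.exp (u ^ 2) := by fun_prop
  have hint := hc.integral_hasStrictDerivAt 0 t |>.hasDerivAt
  have hpoly : HasDerivAt (fun y : ℝ => y - 2 / 3 * y ^ 3) (1 - 2 * t ^ 2) t := by
    refine ((hasDerivAt_id' t).sub ((hasDerivAt_pow 3 t).const_mul (2 / 3))).congr_deriv ?_
    norm_num
    ring
  have hexp : HasDerivAt (fun y : ℝ => Real.exp (y ^ 2)) (Real.exp (t ^ 2) * (2 * t)) t := by
    simpa using (hasDerivAt_pow 2 t).exp
  refine (hint.sub (hpoly.mul hexp)).congr_deriv ?_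
  ring

/-- Dawson-integral lower bound (Appendix B): for `0 < x < 1`,
`e^(-x²) ∫₀^x e^(u²) du > x - (2/3)x³`. -/
theorem dawson_lower_bound (x : ℝ) (hx0 : 0 < x) (hx1 : x < 1) :
    x - 2 / 3 * x ^ 3 < Real.exp (-x ^ 2) * ∫ u in (0 : ℝ)..x, Real.exp (u ^ 2) := by
  have hmono : StrictMonoOn (fun y : ℝ => (∫ u in (0 : ℝ)..y, Real.exp (u ^ 2))
      - (y - 2 / 3 * y ^ 3) * Real.exp (y ^ 2)) (Set.Ici 0) := by
    refine strictMonoOn_of_deriv_pos (convex_Ici 0)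
      (fun t _ => (hasDerivAt_integral_exp_sq_sub t).continuousAt.continuousWithinAt)
      fun t ht => ?_
    rw [interior_Ici, Set.mem_Ioi] at ht
    rw [(hasDerivAt_integral_exp_sq_sub t).deriv]
    positivity
  have h := hmono Set.self_mem_Ici hx0.le hx0
  simp only [integral_same] at h
  rw [Real.exp_neg, inv_mul_eq_div, lt_div_iff₀ (Real.exp_pos _)]
  linarith
end

section
/- Let y > 0 and T > 0, and let Φ denote the standard normal cumulative distribution function. Then ∫₀^∞ (y/(z²·√(2πT)))·(exp(−(1/z − 1/y)²/(2T)) − exp(−(1/z + 1/y)²/(2T))) dz = y·(1 − 2·Φ(−1/(y·√T))). In particular, this integral is strictly less than y. -/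
open MeasureTheory Real

lemma integrable_stdGaussian_density :
    Integrable fun t : ℝ => Real.exp (-t ^ 2 / 2) / Real.sqrt (2 * Real.pi) := by
  have h := (integrable_exp_neg_mul_sq (b := 1 / 2) (by norm_num)).div_const
    (Real.sqrt (2 * Real.pi))
  refine h.congr (Filter.Eventually.of_forall fun t => ?_)
  simp only
  congr 2
  ring

lemma integral_stdGaussian_density :
    ∫ t : ℝ, Real.exp (-t ^ 2 / 2) / Real.sqrt (2 * Real.pi) = 1 := by
  have h := integral_gaussian (1 / 2)
  have e : ∀ t : ℝ, -t ^ 2 / 2 = -(1 / 2) * t ^ 2 := fun t => by ring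
  simp_rw [integral_div, e, h]
  rw [show Real.pi / (1 / 2) = 2 * Real.pi by ring]
  exact div_self (by positivity)

/-- Inversion `u = 1 / (s z)` as a change of variables on the positive half-line. -/
lemma integral_Ioi_comp_inv_mul {s : ℝ} (hs : 0 < s) (g : ℝ → ℝ) :
    ∫ z in Set.Ioi (0 : ℝ), 1 / (s * z ^ 2) * g (1 / (s * z)) =
      ∫ u in Set.Ioi (0 : ℝ), g u := by
  have himage : (fun z : ℝ => 1 / (s * z)) '' Set.Ioi 0 = Set.Ioi 0 := by
    ext u
    simp only [Set.mem_image, Set.mem_Ioi]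
    constructor
    · rintro ⟨z, hz, rfl⟩
      positivity
    · intro hu
      exact ⟨1 / (s * u), by positivity, by field_simp⟩
  have hderiv : ∀ z ∈ Set.Ioi (0 : ℝ),
      HasDerivWithinAt (fun z : ℝ => 1 / (s * z)) (-(1 / (s * z ^ 2))) (Set.Ioi 0) z := by
    intro z hz
    have hz' : z ≠ 0 := ne_of_gt hz
    have h := (((hasDerivAt_id z).const_mul s).inv (mul_ne_zero hs.ne' hz')).hasDerivWithinAt
      (s := Set.Ioi 0)
    refine (h.congr_deriv ?_).congr (fun x _ => ?_) ?_
    · simp only [id]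
      field_simp
    · simp
    · simp
  have hinj : Set.InjOn (fun z : ℝ => 1 / (s * z)) (Set.Ioi 0) := by
    intro a _ b _ hab
    simpa [hs.ne'] using hab
  have h := integral_image_eq_integral_abs_deriv_smul measurableSet_Ioi hderiv hinj g
  rw [himage] at h
  rw [h]
  refine setIntegral_congr_fun measurableSet_Ioi fun z _ => ?_
  have : 0 ≤ 1 / (s * z ^ 2) := by positivity
  simp only [abs_neg, abs_of_nonneg this, smul_eq_mul]

/-- The mass of the half-line under a Gaussian density centred at `a`, less its mass under the
density centred at `-a`. -/
lemma integral_Ioi_stdGaussian_density_sub (a : ℝ) :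
    ∫ u in Set.Ioi (0 : ℝ), (Real.exp (-(u - a) ^ 2 / 2) / Real.sqrt (2 * Real.pi) -
        Real.exp (-(u + a) ^ 2 / 2) / Real.sqrt (2 * Real.pi)) =
      1 - 2 * ∫ t in Set.Iic (-a), Real.exp (-t ^ 2 / 2) / Real.sqrt (2 * Real.pi) := by
  set w : ℝ → ℝ := fun t => Real.exp (-t ^ 2 / 2) / Real.sqrt (2 * Real.pi) with hw
  have hi : Integrable w := integrable_stdGaussian_density
  have hshift (b : ℝ) : ∫ u in Set.Ioi (0 : ℝ), w (u + b) = ∫ t in Set.Ioi b, w t := by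
    have h := (measurePreserving_add_right (volume : Measure ℝ) b).setIntegral_preimage_emb
      (measurableEmbedding_addRight b) w (Set.Ioi b)
    simpa using h
  have hsub : ∫ u in Set.Ioi (0 : ℝ), (w (u - a) - w (u + a)) =
      (∫ u in Set.Ioi (0 : ℝ), w (u + -a)) - ∫ u in Set.Ioi (0 : ℝ), w (u + a) := by
    simp_rw [← sub_eq_add_neg]
    exact integral_sub (hi.comp_sub_right a).integrableOn (hi.comp_add_right a).integrableOn
  have hcompl : (∫ t in Set.Iic (-a), w t) + ∫ t in Set.Ioi (-a), w t = 1 := by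
    rw [intervalIntegral.integral_Iic_add_Ioi hi.integrableOn hi.integrableOn]
    exact integral_stdGaussian_density
  have hsymm : ∫ t in Set.Iic (-a), w t = ∫ t in Set.Ioi a, w t := by
    rw [← integral_comp_neg_Ioi]
    simp [hw]
  change ∫ u in Set.Ioi (0 : ℝ), (w (u - a) - w (u + a)) = 1 - 2 * ∫ t in Set.Iic (-a), w t
  rw [hsub, hshift, hshift]
  linarith

lemma setIntegral_Iic_stdGaussian_density_pos (x : ℝ) :
    0 < ∫ t in Set.Iic x, Real.exp (-t ^ 2 / 2) / Real.sqrt (2 * Real.pi) := by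
  have hpos (t : ℝ) : 0 < Real.exp (-t ^ 2 / 2) / Real.sqrt (2 * Real.pi) := by positivity
  rw [setIntegral_pos_iff_support_of_nonneg_ae
    (Filter.Eventually.of_forall fun t => (hpos t).le)
    integrable_stdGaussian_density.integrableOn]
  rw [Function.support_eq_univ fun t => (hpos t).ne', Set.univ_inter, Real.volume_Iic]
  exact ENNReal.zero_lt_top

/-- First-moment identity for the CEV diffusion `dY = Y² dW` (Table 2 of the paper,
`σ = 1`): integrating `z` against the transition density started at `y > 0` over
horizon `T > 0` gives `E[Y_T | Y_0 = y] = y(1 - 2Φ(-1/(y√T))) < y`, where `Φ` is the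
standard normal CDF. -/
theorem cev_first_moment (y T : ℝ) (hy : 0 < y) (hT : 0 < T)
    (Φ : ℝ → ℝ)
    (hΦ : ∀ x, Φ x = ∫ t in Set.Iic x, Real.exp (-t ^ 2 / 2) / Real.sqrt (2 * Real.pi)) :
    (∫ z in Set.Ioi (0 : ℝ),
        y / (z ^ 2 * Real.sqrt (2 * Real.pi * T)) *
          (Real.exp (-(1 / z - 1 / y) ^ 2 / (2 * T)) -
            Real.exp (-(1 / z + 1 / y) ^ 2 / (2 * T)))) =
      y * (1 - 2 * Φ (-1 / (y * Real.sqrt T))) ∧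
    (∫ z in Set.Ioi (0 : ℝ),
        y / (z ^ 2 * Real.sqrt (2 * Real.pi * T)) *
          (Real.exp (-(1 / z - 1 / y) ^ 2 / (2 * T)) -
            Real.exp (-(1 / z + 1 / y) ^ 2 / (2 * T)))) < y := by
  have hs : 0 < Real.sqrt T := Real.sqrt_pos.mpr hT
  have hmain : (∫ z in Set.Ioi (0 : ℝ),
        y / (z ^ 2 * Real.sqrt (2 * Real.pi * T)) *
          (Real.exp (-(1 / z - 1 / y) ^ 2 / (2 * T)) -
            Real.exp (-(1 / z + 1 / y) ^ 2 / (2 * T)))) =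
      y * (1 - 2 * Φ (-1 / (y * Real.sqrt T))) := by
    rw [hΦ, neg_div, ← integral_Ioi_stdGaussian_density_sub, ← integral_const_mul]
    refine Eq.trans ?_ (integral_Ioi_comp_inv_mul hs _)
    refine setIntegral_congr_fun measurableSet_Ioi fun z hz => ?_
    have hz' : z ≠ 0 := ne_of_gt hz
    have hminus : -(1 / (Real.sqrt T * z) - 1 / (y * Real.sqrt T)) ^ 2 / 2 =
        -(1 / z - 1 / y) ^ 2 / (2 * T) := by
      nth_rewrite 3 [← Real.sq_sqrt hT.le]
      field_simp
    have hplus : -(1 / (Real.sqrt T * z) + 1 / (y * Real.sqrt T)) ^ 2 / 2 =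
        -(1 / z + 1 / y) ^ 2 / (2 * T) := by
      nth_rewrite 3 [← Real.sq_sqrt hT.le]
      field_simp
    simp only [hminus, hplus, Real.sqrt_mul (by positivity : (0 : ℝ) ≤ 2 * Real.pi) T]
    field_simp
  refine ⟨hmain, hmain ▸ ?_⟩
  have hΦpos : 0 < Φ (-1 / (y * Real.sqrt T)) :=
    hΦ _ ▸ setIntegral_Iic_stdGaussian_density_pos _
  nlinarith
end

section
/- Let y > 0 and T > 0. Then ∫₀^∞ (y/(z·√(2πT)))·(exp(−(1/z − 1/y)²/(2T)) − exp(−(1/z + 1/y)²/(2T))) dz = √(2y²/T) · e^(−x²)·∫₀^x e^(u²) du, where x = 1/(y·√(2T)). -/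
open MeasureTheory Real intervalIntegral

lemma exp_linear_sub_sq_eq {T : ℝ} (hT : 0 < T) (s w : ℝ) :
    Real.exp (s * w - w ^ 2 / (2 * T)) =
      Real.exp (T * s ^ 2 / 2) * Real.exp (-(1 / (2 * T)) * (w - T * s) ^ 2) := by
  rw [← Real.exp_add]
  congr 1
  field_simp
  ring

lemma integrable_exp_linear_sub_sq {T : ℝ} (hT : 0 < T) (s : ℝ) :
    Integrable fun w : ℝ => Real.exp (s * w - w ^ 2 / (2 * T)) := by
  simp_rw [exp_linear_sub_sq_eq hT s]
  exact ((integrable_exp_neg_mul_sq (b := 1 / (2 * T)) (by positivity)).comp_sub_right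
    (T * s)).const_mul _

lemma integral_exp_linear_sub_sq {T : ℝ} (hT : 0 < T) (s : ℝ) :
    ∫ w : ℝ, Real.exp (s * w - w ^ 2 / (2 * T)) =
      Real.sqrt (2 * Real.pi * T) * Real.exp (T * s ^ 2 / 2) := by
  simp_rw [exp_linear_sub_sq_eq hT s]
  rw [MeasureTheory.integral_const_mul,
    integral_sub_right_eq_self (fun w : ℝ => Real.exp (-(1 / (2 * T)) * w ^ 2)) (T * s),
    integral_gaussian, mul_comm]
  congr 2
  field_simp

/-- Folding the Gaussian integral of an exponential onto the half-line. -/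
lemma integral_Ioi_exp_linear_sub_sq_add {T : ℝ} (hT : 0 < T) (s : ℝ) :
    ∫ w in Set.Ioi (0 : ℝ),
        (Real.exp (s * w - w ^ 2 / (2 * T)) + Real.exp (-s * w - w ^ 2 / (2 * T))) =
      Real.sqrt (2 * Real.pi * T) * Real.exp (T * s ^ 2 / 2) := by
  have h := integrable_exp_linear_sub_sq hT s
  have hneg : ∫ w in Set.Ioi (0 : ℝ), Real.exp (-s * w - w ^ 2 / (2 * T)) =
      ∫ w in Set.Iic (0 : ℝ), Real.exp (s * w - w ^ 2 / (2 * T)) := by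
    have := integral_comp_neg_Ioi (0 : ℝ) fun w : ℝ => Real.exp (s * w - w ^ 2 / (2 * T))
    simpa using this
  rw [integral_add h.integrableOn (integrable_exp_linear_sub_sq hT (-s)).integrableOn, hneg,
    add_comm, integral_Iic_add_Ioi h.integrableOn h.integrableOn, integral_exp_linear_sub_sq hT]

lemma intervalIntegral_exp_mul_add (c w : ℝ) (hw : w ≠ 0) :
    ∫ s in (0 : ℝ)..c, (Real.exp (s * w) + Real.exp (-s * w)) =
      (Real.exp (c * w) - Real.exp (-c * w)) / w := by
  have hderiv : ∀ s ∈ Set.uIcc 0 c,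
      HasDerivAt (fun s : ℝ => (Real.exp (s * w) - Real.exp (-s * w)) / w)
        (Real.exp (s * w) + Real.exp (-s * w)) s := by
    intro s _
    have h1 := ((hasDerivAt_id s).mul_const w).exp
    have h2 := ((hasDerivAt_id s).neg.mul_const w).exp
    refine ((h1.sub h2).div_const w).congr_deriv ?_
    simp only [id, Pi.neg_apply]
    field_simp
    ring
  rw [integral_eq_sub_of_hasDerivAt hderiv
    (Continuous.intervalIntegrable (by fun_prop) _ _)]
  simp

lemma integrable_prod_exp_linear_sub_sq_add {T c : ℝ} (hT : 0 < T) :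
    Integrable (fun p : ℝ × ℝ =>
        Real.exp (p.2 * p.1 - p.1 ^ 2 / (2 * T)) + Real.exp (-p.2 * p.1 - p.1 ^ 2 / (2 * T)))
      ((volume.restrict (Set.Ioi 0)).prod (volume.restrict (Set.Ioc 0 c))) := by
  have hbound : Integrable (fun p : ℝ × ℝ => 2 * Real.exp (c * p.1 - p.1 ^ 2 / (2 * T)))
      ((volume.restrict (Set.Ioi 0)).prod (volume.restrict (Set.Ioc 0 c))) :=
    ((integrable_exp_linear_sub_sq hT c).integrableOn.comp_fst _).const_mul 2
  refine hbound.mono' (Continuous.aestronglyMeasurable (by fun_prop)) ?_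
  rw [Measure.prod_restrict]
  filter_upwards [ae_restrict_mem (measurableSet_Ioi.prod measurableSet_Ioc)] with p hp
  obtain ⟨hw, hs0, hsc⟩ := hp
  rw [Set.mem_Ioi] at hw
  rw [Real.norm_of_nonneg (by positivity), two_mul (Real.exp _)]
  exact add_le_add (Real.exp_le_exp.2 (by nlinarith)) (Real.exp_le_exp.2 (by nlinarith))

lemma integral_Ioi_exp_sub_exp_div {T c : ℝ} (hT : 0 < T) (hc : 0 ≤ c) :
    ∫ w in Set.Ioi (0 : ℝ),
        (Real.exp (c * w) - Real.exp (-c * w)) / w * Real.exp (-(w ^ 2 / (2 * T))) =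
      Real.sqrt (2 * Real.pi * T) * ∫ s in (0 : ℝ)..c, Real.exp (T * s ^ 2 / 2) := by
  have h1 : ∫ w in Set.Ioi (0 : ℝ),
        (Real.exp (c * w) - Real.exp (-c * w)) / w * Real.exp (-(w ^ 2 / (2 * T))) =
      ∫ w in Set.Ioi (0 : ℝ), ∫ s in Set.Ioc 0 c,
        (Real.exp (s * w - w ^ 2 / (2 * T)) + Real.exp (-s * w - w ^ 2 / (2 * T))) := by
    refine setIntegral_congr_fun measurableSet_Ioi fun w hw => ?_
    rw [← intervalIntegral_exp_mul_add c w (ne_of_gt hw), ← intervalIntegral.integral_mul_const,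
      integral_of_le hc]
    simp only [add_mul, ← Real.exp_add, sub_eq_add_neg]
  rw [h1, integral_integral_swap (integrable_prod_exp_linear_sub_sq_add hT)]
  simp_rw [integral_Ioi_exp_linear_sub_sq_add hT]
  rw [MeasureTheory.integral_const_mul, integral_of_le hc]

/-- Invariance of `dz / z` on the half-line under inversion. -/
lemma integral_Ioi_inv_mul_comp_inv (f : ℝ → ℝ) :
    ∫ z in Set.Ioi (0 : ℝ), z⁻¹ * f z⁻¹ = ∫ w in Set.Ioi (0 : ℝ), w⁻¹ * f w := by
  rw [← integral_comp_rpow_Ioi (fun w : ℝ => w⁻¹ * f w) (p := -1) (by norm_num)]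
  refine setIntegral_congr_fun measurableSet_Ioi fun z hz => ?_
  have hz : 0 < z := hz
  have h2 : z ^ ((-1 : ℝ) - 1) = z⁻¹ * z⁻¹ := by
    rw [sub_eq_add_neg, Real.rpow_add hz, Real.rpow_neg_one]
  simp only [h2, Real.rpow_neg_one, smul_eq_mul, abs_neg, abs_one, inv_inv]
  field_simp

/-- Second-moment identity for the CEV diffusion `dY = Y² dW` (Table 2 of the paper,
`σ = 1`): integrating `z²` against the transition density started at `y > 0` over
horizon `T > 0` gives `E[Y_T² | Y_0 = y] = √(2y²/T) · D₊(1/(y√(2T)))`, where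
`D₊(x) = e^(-x²) ∫₀^x e^(u²) du` is the Dawson integral. -/
theorem cev_second_moment (y T : ℝ) (hy : 0 < y) (hT : 0 < T)
    (x : ℝ) (hx : x = 1 / (y * Real.sqrt (2 * T))) :
    (∫ z in Set.Ioi (0 : ℝ),
        y / (z * Real.sqrt (2 * Real.pi * T)) *
          (Real.exp (-(1 / z - 1 / y) ^ 2 / (2 * T)) -
            Real.exp (-(1 / z + 1 / y) ^ 2 / (2 * T)))) =
      Real.sqrt (2 * y ^ 2 / T) *
        (Real.exp (-x ^ 2) * ∫ u in (0 : ℝ)..x, Real.exp (u ^ 2)) := by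
  set r := Real.sqrt (2 * T) with hr
  have hr0 : 0 < r := Real.sqrt_pos.2 (by positivity)
  have hr2 : r ^ 2 = 2 * T := Real.sq_sqrt (by positivity)
  have hTr : T = r ^ 2 / 2 := by linarith
  set q := Real.sqrt (2 * Real.pi * T) with hq
  have hq0 : 0 < q := Real.sqrt_pos.2 (by positivity)
  set c := 1 / (y * T) with hc
  have hc0 : 0 ≤ c := by positivity
  have hexp (w a : ℝ) : Real.exp (-(w + a * (1 / y)) ^ 2 / (2 * T)) =
      Real.exp (-(a ^ 2 * x ^ 2)) * (Real.exp (-(a * c) * w) * Real.exp (-(w ^ 2 / (2 * T)))) := by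
    rw [← Real.exp_add, ← Real.exp_add]
    congr 1
    rw [hx, hc, hTr]
    field_simp
    ring
  have hleft : (∫ z in Set.Ioi (0 : ℝ), y / (z * q) *
      (Real.exp (-(1 / z - 1 / y) ^ 2 / (2 * T)) - Real.exp (-(1 / z + 1 / y) ^ 2 / (2 * T)))) =
      y / q * Real.exp (-x ^ 2) * ∫ w in Set.Ioi (0 : ℝ),
        (Real.exp (c * w) - Real.exp (-c * w)) / w * Real.exp (-(w ^ 2 / (2 * T))) := by
    have hinv := integral_Ioi_inv_mul_comp_inv fun w =>
      y / q * (Real.exp (-(w - 1 / y) ^ 2 / (2 * T)) - Real.exp (-(w + 1 / y) ^ 2 / (2 * T)))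
    rw [← MeasureTheory.integral_const_mul]
    refine Eq.trans ?_ (hinv.trans ?_)
    · refine integral_congr_ae (.of_forall fun z => ?_)
      simp only [div_eq_mul_inv, mul_inv, one_mul]
      ring
    · refine integral_congr_ae (.of_forall fun w => ?_)
      have hminus := hexp w (-1)
      have hplus := hexp w 1
      simp only [neg_one_mul, ← sub_eq_add_neg, neg_neg, one_mul, one_pow, neg_one_sq]
        at hminus hplus
      simp only [hminus, hplus]
      ring
  have hsqrt : Real.sqrt (2 * y ^ 2 / T) = y * (2 / r) := by
    rw [Real.sqrt_eq_iff_mul_self_eq (by positivity) (by positivity), hTr]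
    field_simp
  have hright : ∫ s in (0 : ℝ)..c, Real.exp (T * s ^ 2 / 2) =
      2 / r * ∫ u in (0 : ℝ)..x, Real.exp (u ^ 2) := by
    have hsub := mul_integral_comp_mul_right (a := 0) (b := c)
      (f := fun u : ℝ => Real.exp (u ^ 2)) (r / 2)
    have hxc : c * (r / 2) = x := by
      rw [hx, hc, hTr]
      field_simp
    rw [zero_mul, hxc] at hsub
    rw [← hsub, ← mul_assoc, show 2 / r * (r / 2) = 1 by field_simp, one_mul]
    congr 1
    ext s
    rw [hTr]
    ring_nf
  rw [hleft, integral_Ioi_exp_sub_exp_div hT hc0, hright, hsqrt, ← hq]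
  field_simp
end
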